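/- There is no finite group G with exactly 6 conjugacy classes, with class representatives g₁,…,g₆ and irreducible characters χ₁,…,χ₆ (in some order), whose character table equals the 6×6 matrix with rows (1,1,1,1,1,1), (1,1,1,1,−1,−1), (1,1,1,−1,1,−1), (1,1,1,−1,−1,1), (2,2,−2,0,0,0), (4,−2,0,0,0,0); that is, there is no such G with χᵢ(gⱼ) equal to the (i,j) entry of this matrix for all 1 ≤ i, j ≤ 6. -/

import Mathlib

open CategoryTheory

/-- `χ : G → ℂ` is the character of an irreducible (simple) finite-dimensional complex
representation of the group `G`. -/
def IsIrrChar (G : Type) [Group G] (χ : G → ℂ) : Prop :=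
  ∃ V : FDRep ℂ G, Simple V ∧ FDRep.character V = χ

/-- The second matrix from the paper: a pseudo character table. -/
def pseudoTable : Matrix (Fin 6) (Fin 6) ℂ :=
  !![1,  1,  1,  1,  1,  1;
     1,  1,  1,  1, -1, -1;
     1,  1,  1, -1,  1, -1;
     1,  1,  1, -1, -1,  1;
     2,  2, -2,  0,  0,  0;
     4, -2,  0,  0,  0,  0]

theorem IsIrrChar.eq_of_isConj {G : Type} [Group G] {ψ : G → ℂ} (h : IsIrrChar G ψ) {x y : G}
    (hxy : IsConj x y) : ψ x = ψ y := by
  obtain ⟨V, -, rfl⟩ := h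
  obtain ⟨c, rfl⟩ := isConj_iff.1 hxy
  exact (V.char_conj x c).symm

theorem IsIrrChar.exists_map_one {G : Type} [Group G] {ψ : G → ℂ} (h : IsIrrChar G ψ) :
    ∃ n : ℕ, ψ 1 = n := by
  obtain ⟨V, -, rfl⟩ := h
  exact ⟨_, V.char_one⟩

theorem IsIrrChar.map_mul_of_map_one {G : Type} [Group G] {ψ : G → ℂ} (h : IsIrrChar G ψ)
    (h1 : ψ 1 = 1) (x y : G) : ψ (x * y) = ψ x * ψ y := by
  obtain ⟨V, -, rfl⟩ := h
  have hd : Module.finrank ℂ V = 1 := by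
    rw [FDRep.char_one] at h1
    exact_mod_cast h1
  obtain ⟨a, ha, -⟩ := LinearMap.existsUnique_eq_smul_id_of_finrank_eq_one hd (V.ρ x)
  obtain ⟨b, hb, -⟩ := LinearMap.existsUnique_eq_smul_id_of_finrank_eq_one hd (V.ρ y)
  simp only [FDRep.character, map_mul, ha, hb]
  simp [hd, smul_smul, LinearMap.trace_id, Module.End.mul_eq_comp, mul_comm]

/-- A nontrivial irreducible character sums to zero over the group. -/
theorem IsIrrChar.sum_eq_zero {G : Type} [Group G] [Fintype G] {ψ : G → ℂ} (h : IsIrrChar G ψ)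
    (h1 : IsIrrChar G fun _ => 1) (hne : ψ ≠ fun _ => 1) : ∑ x, ψ x = 0 := by
  classical
  obtain ⟨V, hV, rfl⟩ := h
  obtain ⟨W, hW, hW1⟩ := h1
  have hcard : (Nat.card G : ℂ) ≠ 0 := by exact_mod_cast Nat.card_pos.ne'
  have : Invertible (Nat.card G : ℂ) := invertibleOfNonzero hcard
  have key := FDRep.char_orthonormal V W
  rw [if_neg fun ⟨e⟩ => hne ((FDRep.char_iso e).trans hW1)] at key
  simpa [hW1, hcard] using key

theorem card_isConj_mul_card_centralizer {G : Type} [Group G] [Finite G] (a : G) :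
    Nat.card {x // IsConj a x} * Nat.card (Subgroup.centralizer {a}) = Nat.card G := by
  have h := Nat.card_congr (MulAction.orbitProdStabilizerEquivGroup (ConjAct G) a)
  rw [Nat.card_prod, ← Subgroup.nat_card_centralizer_nat_card_stabilizer] at h
  have h2 : Nat.card (MulAction.orbit (ConjAct G) a) = Nat.card {x // IsConj a x} :=
    Nat.card_congr (Equiv.subtypeEquivRight fun x => by
      rw [ConjAct.mem_orbit_conjAct, isConj_comm])
  rw [h2] at h
  exact h.trans (Nat.card_congr ConjAct.ofConjAct.toEquiv)

theorem IsConj.orderOf_eq {G : Type*} [Group G] {x y : G} (h : IsConj x y) :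
    orderOf x = orderOf y := by
  obtain ⟨c, rfl⟩ := isConj_iff.1 h
  exact SemiconjBy.orderOf_eq c (by simp [SemiconjBy])

/-- The order of a normal subgroup is the sum of the sizes of the conjugacy classes contained in it,
where the classes are the fibres of `c` and are represented by the values of `g`. -/
theorem Subgroup.card_eq_sum_card_fiber {G ι : Type*} [Group G] [Fintype G] [Fintype ι]
    [DecidableEq ι] (H : Subgroup G) [hH : H.Normal] [DecidablePred (· ∈ H)] (g : ι → G) (c : G → ι)
    (hc : ∀ x, IsConj (g (c x)) x) :
    Nat.card H = ∑ j, if g j ∈ H then (Finset.univ.filter fun x => c x = j).card else 0 := by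
  have hmem (x : G) : x ∈ H ↔ g (c x) ∈ H := by
    obtain ⟨b, hb⟩ := isConj_iff.1 (hc x)
    conv_lhs => rw [← hb, hH.mem_comm_iff, inv_mul_cancel_left]
  rw [Nat.card_eq_fintype_card, Fintype.card_subtype,
    Finset.card_eq_sum_card_fiberwise (f := c) (t := Finset.univ) (by intro x; simp)]
  refine Finset.sum_congr rfl fun j _ => ?_
  rw [Finset.filter_filter]
  split_ifs with h
  · congr 1
    ext x
    simp only [Finset.mem_filter, Finset.mem_univ, true_and, and_iff_right_iff_imp]
    rintro rfl
    exact (hmem x).2 h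
  · rw [Finset.card_eq_zero, Finset.filter_eq_empty_iff]
    rintro x - ⟨hx, rfl⟩
    exact h ((hmem x).1 hx)

theorem no_group_with_pseudo_table (G : Type) [Group G] [Finite G]
    (g : Fin 6 → G) (χ : Fin 6 → G → ℂ)
    (hrep : ∀ x : G, ∃ i, IsConj (g i) x)
    (hdistinct : ∀ i j : Fin 6, IsConj (g i) (g j) → i = j)
    (hirr : ∀ i, IsIrrChar G (χ i))
    (hinj : Function.Injective χ)
    (hall : ∀ ψ : G → ℂ, IsIrrChar G ψ → ∃ i, χ i = ψ)
    (htable : ∀ i j : Fin 6, χ i (g j) = pseudoTable i j) :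
    False := by
  classical
  have : Fintype G := Fintype.ofFinite G
  choose c hc using hrep
  have hcg (j : Fin 6) : c (g j) = j := hdistinct _ _ (hc _)
  have hχ (i : Fin 6) (x : G) : χ i x = pseudoTable i (c x) := by
    rw [← htable, (hirr i).eq_of_isConj (hc x)]
  have hc_iff (j : Fin 6) (x : G) : c x = j ↔ IsConj (g j) x :=
    ⟨fun h => h ▸ hc x, fun h => hdistinct _ _ ((hc x).trans h.symm)⟩
  -- The identity is the first class representative.
  have hc1 : c 1 = 0 := by
    have h (i : Fin 6) : ∃ n : ℕ, pseudoTable i (c 1) = n := hχ i 1 ▸ (hirr i).exists_map_one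
    have neg (m : ℕ) (hm : m ≠ 0) : ¬ ∃ n : ℕ, (-(m : ℂ)) = n := by
      rintro ⟨n, hn⟩
      have : ((m + n : ℕ) : ℂ) = 0 := by push_cast; rw [← hn]; ring
      rw [Nat.cast_eq_zero] at this
      omega
    have h1 := neg 1 one_ne_zero
    have h2 := neg 2 two_ne_zero
    push_cast at h1 h2
    generalize c 1 = k at h
    fin_cases k
    · rfl
    · exact (h2 (by simpa [pseudoTable] using h 5)).elim
    · exact (h2 (by simpa [pseudoTable] using h 4)).elim
    · exact (h1 (by simpa [pseudoTable] using h 2)).elim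
    · exact (h1 (by simpa [pseudoTable] using h 1)).elim
    · exact (h1 (by simpa [pseudoTable] using h 1)).elim
  have hc_zero (x : G) : c x = 0 ↔ x = 1 := by
    refine ⟨fun h => ?_, fun h => h ▸ hc1⟩
    exact isConj_one_right.1 ((hc_iff _ _).1 hc1 |>.symm.trans ((hc_iff _ _).1 h))
  have hg0 : g 0 = 1 := (hc_zero _).1 (hcg 0)
  -- Orthogonality to the trivial character determines the class sizes.
  let n (j : Fin 6) : ℕ := (Finset.univ.filter fun x => c x = j).card
  have hχ0 : χ 0 = fun _ => 1 := by
    funext x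
    rw [hχ]
    generalize c x = j
    fin_cases j <;> simp [pseudoTable]
  have hsum (i : Fin 6) (hi : i ≠ 0) : ∑ j, (n j : ℂ) * pseudoTable i j = 0 := by
    rw [← (hirr i).sum_eq_zero (hχ0 ▸ hirr 0) fun h => hi (hinj (h.trans hχ0.symm)),
      ← Finset.sum_fiberwise _ c]
    refine Finset.sum_congr rfl fun j _ => ?_
    rw [Finset.sum_congr rfl (g := fun _ => pseudoTable i j), Finset.sum_const, nsmul_eq_mul]
    intro x hx
    rw [hχ, (Finset.mem_filter.1 hx).2]
  have hn0 : n 0 = 1 := by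
    simp only [n, hc_zero]
    exact Finset.card_eq_one.2 ⟨1, by ext; simp⟩
  obtain ⟨hn1, hn2, hn3, hn4, hn5⟩ : n 1 = 2 ∧ n 2 = 3 ∧ n 3 = 6 ∧ n 4 = 6 ∧ n 5 = 6 := by
    have e1 := hsum 1 (by decide)
    have e2 := hsum 2 (by decide)
    have e3 := hsum 3 (by decide)
    have e4 := hsum 4 (by decide)
    have e5 := hsum 5 (by decide)
    simp only [Fin.sum_univ_six, pseudoTable, hn0] at e1 e2 e3 e4 e5
    simp [-mul_eq_zero] at e1 e2 e3 e4 e5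
    refine ⟨?_, ?_, ?_, ?_, ?_⟩ <;> rify <;> apply Complex.ofReal_injective <;> push_cast <;> grind
  have hcardG : Nat.card G = 24 := by
    rw [← Subgroup.card_top, Subgroup.card_eq_sum_card_fiber ⊤ g c hc]
    change (∑ j, if g j ∈ _ then n j else 0) = _
    simp [Fin.sum_univ_six, hn0, hn1, hn2, hn3, hn4, hn5]
  -- The common kernel of the linear characters is a normal subgroup of order six.
  have hmul1 := (hirr 1).map_mul_of_map_one (by rw [hχ, hc1]; simp [pseudoTable])
  have hmul2 := (hirr 2).map_mul_of_map_one (by rw [hχ, hc1]; simp [pseudoTable])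
  have hker (x : G) : (χ 1 x = 1 ∧ χ 2 x = 1) ↔ c x = 0 ∨ c x = 1 ∨ c x = 2 := by
    rw [hχ, hχ]
    generalize c x = j
    have : (-1 : ℂ) ≠ 1 := by norm_num
    fin_cases j <;> simp [pseudoTable, this]
  let K : Subgroup G :=
    { carrier := {x | χ 1 x = 1 ∧ χ 2 x = 1}
      one_mem' := (hker 1).2 (Or.inl hc1)
      mul_mem' := fun {x y} hx hy =>
        ⟨by rw [hmul1, hx.1, hy.1, one_mul], by rw [hmul2, hx.2, hy.2, one_mul]⟩
      inv_mem' := fun {x} hx => by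
        have h1 := (hker 1).2 (Or.inl hc1)
        rw [← mul_inv_cancel x, hmul1, hmul2, hx.1, hx.2, one_mul, one_mul] at h1
        exact h1 }
  have hK (x : G) : x ∈ K ↔ c x = 0 ∨ c x = 1 ∨ c x = 2 := hker x
  have : K.Normal := ⟨fun x hx y => by
    refine ⟨?_, ?_⟩
    · exact ((hirr 1).eq_of_isConj (isConj_iff.2 ⟨y, rfl⟩)).symm.trans hx.1
    · exact ((hirr 2).eq_of_isConj (isConj_iff.2 ⟨y, rfl⟩)).symm.trans hx.2⟩
  have hcardK : Nat.card K = 6 := by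
    rw [Subgroup.card_eq_sum_card_fiber K g c hc]
    change (∑ j, if g j ∈ _ then n j else 0) = _
    simp [Fin.sum_univ_six, hn0, hn1, hn2, hK, hcg]
  -- The centralizer of `g 1` has index two, and counting shows that it contains `g 2`.
  have hindex : (Subgroup.centralizer {g 1}).index = 2 := by
    have h1 := card_isConj_mul_card_centralizer (g 1)
    have h2 : Nat.card {x // IsConj (g 1) x} = n 1 := by
      simp only [← hc_iff, Nat.card_eq_fintype_card, Fintype.card_subtype, n]
    have h3 := (Subgroup.centralizer {g 1}).card_mul_index
    rw [h2, hn1, hcardG] at h1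
    rw [hcardG] at h3
    have h4 : Nat.card (Subgroup.centralizer {g 1}) = 12 := by omega
    rw [h4] at h3
    omega
  have := Subgroup.normal_of_index_eq_two hindex
  have hcomm : Commute (g 1) (g 2) := by
    have h0 : g 0 ∈ Subgroup.centralizer {g 1} := hg0 ▸ one_mem _
    have h1 : g 1 ∈ Subgroup.centralizer {g 1} := Subgroup.mem_centralizer_singleton_iff.2 rfl
    suffices h : g 2 ∈ Subgroup.centralizer {g 1} from
      (Subgroup.mem_centralizer_singleton_iff.1 h).symm
    by_contra h2
    have hcard := Subgroup.card_eq_sum_card_fiber (Subgroup.centralizer {g 1}) g c hc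
    change _ = (∑ j, if g j ∈ _ then n j else 0) at hcard
    have h3 := (Subgroup.centralizer {g 1}).card_mul_index
    rw [hindex, hcardG] at h3
    simp only [Fin.sum_univ_six, hn0, hn1, hn3, hn4, hn5, if_pos h0, if_pos h1, if_neg h2]
      at hcard
    split_ifs at hcard <;> omega
  -- Elements of order two and three make up the two nontrivial classes in `K`, so `g 1 * g 2` has
  -- order six, while no class in `K` does.
  have horder (x : G) : orderOf (g (c x)) = orderOf x := (hc x).orderOf_eq
  have : Fact (Nat.Prime 2) := ⟨Nat.prime_two⟩
  have : Fact (Nat.Prime 3) := ⟨Nat.prime_three⟩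
  obtain ⟨⟨u, huK⟩, hu⟩ := exists_prime_orderOf_dvd_card' (G := K) 2 (by rw [hcardK]; norm_num)
  obtain ⟨⟨v, hvK⟩, hv⟩ := exists_prime_orderOf_dvd_card' (G := K) 3 (by rw [hcardK]; norm_num)
  rw [Subgroup.orderOf_mk, ← horder] at hu hv
  have ho0 : orderOf (g 0) = 1 := by rw [hg0, orderOf_one]
  have ho : orderOf (g 1) = 2 ∧ orderOf (g 2) = 3 ∨ orderOf (g 1) = 3 ∧ orderOf (g 2) = 2 := by
    rcases (hK u).1 huK with h | h | h <;> rcases (hK v).1 hvK with h' | h' | h' <;>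
      rw [h] at hu <;> rw [h'] at hv <;> omega
  have hmulK : g 1 * g 2 ∈ K := mul_mem ((hK _).2 (by simp [hcg])) ((hK _).2 (by simp [hcg]))
  have h12 := hcomm.orderOf_mul_eq_mul_orderOf_of_coprime
    (by rcases ho with ⟨h, h'⟩ | ⟨h, h'⟩ <;> rw [h, h'] <;> norm_num)
  rw [← horder] at h12
  rcases ho with ⟨h1, h2⟩ | ⟨h1, h2⟩ <;> rcases (hK _).1 hmulK with h | h | h <;>
    rw [h, h1, h2] at h12 <;> omega
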